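/- Let μ satisfy (aa) and define g(t) = (1/π) ∫₀^∞ e^{−rt} · (∫₀¹ sin(πα) r^α μ(α) dα) / [ (∫₀¹ cos(πα) r^α μ(α) dα)² + (∫₀¹ sin(πα) r^α μ(α) dα)² ] dr. Then g is nonnegative and locally integrable on [0,∞), there exist c > 0 and γ ∈ (0, 1/2) (depending only on μ) with g(t) ≤ c · max{t^{γ−1}, t^{−γ}} for all t > 0, and for every T > 0: (i) for every u ∈ L^∞(0,T), (d/dt) ∫₀^t k(t−s) (g*u)(s) ds = u(t) for a.e. t ∈ (0,T); (ii) for every absolutely continuous u on [0,T], ∫₀^t g(t−s) (k*u′)(s) ds = u(t) − u(0) for all t ∈ [0,T]. -/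

import Mathlib

open MeasureTheory Set Real

/-- The kernel `k(t) = ∫₀¹ t^{-α} μ(α)/Γ(1-α) dα`. -/
noncomputable def kker (μ : ℝ → ℝ) (t : ℝ) : ℝ :=
  ∫ α in Ioo (0:ℝ) 1, t ^ (-α) * μ α / Real.Gamma (1 - α)

/-- The kernel `g` given by formula (calka). -/
noncomputable def gker (μ : ℝ → ℝ) (t : ℝ) : ℝ :=
  (1 / π) * ∫ r in Ioi (0:ℝ),
    Real.exp (-r * t) *
      ((∫ α in Ioo (0:ℝ) 1, Real.sin (π * α) * r ^ α * μ α) /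
        ((∫ α in Ioo (0:ℝ) 1, Real.cos (π * α) * r ^ α * μ α) ^ 2 +
          (∫ α in Ioo (0:ℝ) 1, Real.sin (π * α) * r ^ α * μ α) ^ 2))

open Filter Topology ProbabilityTheory

section UnitInterval

variable {M : Measure ℝ} [IsFiniteMeasure M]

lemma integrable_exp_mul_of_ae_mem_Ioo (hM : ∀ᵐ α ∂M, α ∈ Ioo (0:ℝ) 1) (x : ℝ) :
    Integrable (fun α => rexp (x * α)) M := by
  refine Integrable.of_bound (by fun_prop) (rexp |x|) ?_
  filter_upwards [hM] with α hα
  rw [Real.norm_eq_abs, abs_exp]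
  refine exp_le_exp.2 ((le_abs_self _).trans ?_)
  rw [abs_mul, abs_of_pos hα.1]
  exact mul_le_of_le_one_right (abs_nonneg x) hα.2.le

lemma differentiable_complexMGF_of_ae_mem_Ioo (hM : ∀ᵐ α ∂M, α ∈ Ioo (0:ℝ) 1) :
    Differentiable ℂ (complexMGF id M) := by
  have h : integrableExpSet id M = univ :=
    eq_univ_of_forall fun x => integrable_exp_mul_of_ae_mem_Ioo hM x
  have := differentiableOn_complexMGF (X := id) (μ := M)
  rw [h] at this
  simpa [differentiableOn_univ] using this

lemma integrable_cexp_mul_of_ae_mem_Ioo (hM : ∀ᵐ α ∂M, α ∈ Ioo (0:ℝ) 1) (z : ℂ) :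
    Integrable (fun α : ℝ => Complex.exp (z * α)) M := by
  refine (integrable_exp_mul_of_ae_mem_Ioo hM z.re).mono' (by fun_prop) (ae_of_all _ fun α => ?_)
  simp [Complex.norm_exp]

lemma exists_Icc_measure_pos (hM : ∀ᵐ α ∂M, α ∈ Ioo (0:ℝ) 1) (hM0 : M ≠ 0) :
    ∃ γ ∈ Ioo (0:ℝ) (1/2), 0 < M.real (Icc γ (1 - γ)) := by
  by_contra! h
  refine hM0 (Measure.measure_univ_eq_zero.1 ?_)
  have h1 : ∀ n : ℕ, M (Icc (1 / ((n:ℝ) + 3)) (1 - 1 / ((n:ℝ) + 3))) = 0 := fun n => by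
    have h2 := h (1 / ((n:ℝ) + 3)) ⟨by positivity, by
      rw [div_lt_div_iff₀ (by positivity) (by norm_num)]; linarith [(n.cast_nonneg : (0:ℝ) ≤ n)]⟩
    exact (measureReal_eq_zero_iff).1 (le_antisymm h2 measureReal_nonneg)
  have h3 := measure_iUnion_null h1
  refine measure_mono_null_ae ?_ h3
  filter_upwards [hM] with α hα _
  obtain ⟨n, hn⟩ := exists_nat_gt (max (1 / α) (1 / (1 - α)))
  have hα1 : 0 < 1 - α := by linarith [hα.2]
  refine mem_iUnion.2 ⟨n, ?_, ?_⟩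
  · rw [one_div_le (by positivity) hα.1]
    linarith [le_max_left (1 / α) (1 / (1 - α))]
  · have : 1 / ((n:ℝ) + 3) ≤ 1 - α := by
      rw [one_div_le (by positivity) hα1]
      linarith [le_max_right (1 / α) (1 / (1 - α))]
    linarith

/-- Away from the slit, the symbol `z ↦ ∫ z ^ α dM(α)`, written in the logarithmic coordinate,
is bounded below by powers. -/
lemma exists_lower_bound_complexMGF (hM : ∀ᵐ α ∂M, α ∈ Ioo (0:ℝ) 1) (hM0 : M ≠ 0) :
    ∃ c > 0, ∃ γ ∈ Ioo (0:ℝ) (1/2), ∀ w : ℂ, |w.im| ≤ π →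
      c * min (rexp (γ * w.re)) (rexp ((1 - γ) * w.re)) ≤ ‖complexMGF id M w‖ := by
  obtain ⟨γ, hγ, hγM⟩ := exists_Icc_measure_pos hM hM0
  have hsin : 0 < sin (π * γ) := sin_pos_of_pos_of_lt_pi (by have := hγ.1; positivity)
    (by nlinarith [pi_pos, hγ.2])
  refine ⟨sin (π * γ) * M.real (Icc γ (1 - γ)), by positivity, γ, hγ, fun w hw => ?_⟩
  set m := min (rexp (γ * w.re)) (rexp ((1 - γ) * w.re)) with hm
  have hm0 : 0 < m := by positivity
  have e1 : ‖complexMGF id M w‖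
      = ‖∫ α : ℝ, Complex.exp (w * α) * Complex.exp (-(w.im / 2 : ℝ) * Complex.I) ∂M‖ := by
    rw [integral_mul_const, norm_mul, ← Complex.ofReal_neg, Complex.norm_exp_ofReal_mul_I, mul_one]
    rfl
  have hi : Integrable (fun α : ℝ => Complex.exp (w * α) *
      Complex.exp (-(w.im / 2 : ℝ) * Complex.I)) M :=
    (integrable_cexp_mul_of_ae_mem_Ioo hM w).mul_const _
  rw [e1]
  refine le_trans ?_ (Complex.re_le_norm _)
  have e2 : (∫ α : ℝ, Complex.exp (w * α) * Complex.exp (-(w.im / 2 : ℝ) * Complex.I) ∂M).re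
      = ∫ α : ℝ, rexp (w.re * α) * cos (w.im * (α - 1 / 2)) ∂M := by
    have := (integral_re hi)
    simp only [RCLike.re_to_complex] at this
    rw [← this]
    refine integral_congr_ae (ae_of_all _ fun α => ?_)
    simp only [← Complex.exp_add]
    rw [Complex.exp_re]
    simp
    congr 1
    ring
  have e3 : sin (π * γ) * M.real (Icc γ (1 - γ)) * m
      = ∫ α, (Icc γ (1 - γ)).indicator (fun _ => sin (π * γ) * m) α ∂M := by
    rw [integral_indicator_const _ measurableSet_Icc, smul_eq_mul]; ring
  rw [e2, e3]
  refine integral_mono_ae ((integrable_const _).indicator measurableSet_Icc) ?_ ?_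
  · refine (integrable_exp_mul_of_ae_mem_Ioo hM w.re).mul_bdd (c := 1) (by fun_prop)
      (ae_of_all _ fun α => ?_)
    exact abs_cos_le_one _
  · filter_upwards [hM] with α hα
    have hle : |w.im * (α - 1 / 2)| ≤ π * |α - 1 / 2| := by
      rw [abs_mul]; gcongr
    by_cases hαγ : α ∈ Icc γ (1 - γ)
    · rw [indicator_of_mem hαγ, mul_comm]
      have h1 : m ≤ rexp (w.re * α) := by
        rcases le_total 0 w.re with h | h
        · refine (min_le_left _ _).trans (exp_le_exp.2 ?_)
          nlinarith [hαγ.1]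
        · refine (min_le_right _ _).trans (exp_le_exp.2 ?_)
          nlinarith [hαγ.2]
      have h2 : sin (π * γ) ≤ cos (w.im * (α - 1 / 2)) := by
        rw [← cos_pi_div_two_sub, ← cos_abs (w.im * _)]
        have h3 : |α - 1 / 2| ≤ 1 / 2 - γ := abs_le.2 ⟨by linarith [hαγ.1], by linarith [hαγ.2]⟩
        refine cos_le_cos_of_nonneg_of_le_pi (abs_nonneg _) ?_ ?_
        · nlinarith [pi_pos, hγ.1]
        · nlinarith [pi_pos]
      gcongr
    · rw [indicator_of_notMem hαγ]
      refine mul_nonneg (exp_pos _).le (cos_nonneg_of_mem_Icc (abs_le.1 (hle.trans ?_)))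
      have h3 : |α - 1 / 2| ≤ 1 / 2 := abs_le.2 ⟨by linarith [hα.1], by linarith [hα.2]⟩
      nlinarith [pi_pos]



lemma exists_norm_inv_complexMGF_le (hM : ∀ᵐ α ∂M, α ∈ Ioo (0:ℝ) 1) (hM0 : M ≠ 0) :
    ∃ c > 0, ∃ γ ∈ Ioo (0:ℝ) (1/2), ∀ w : ℂ, |w.im| ≤ π → complexMGF id M w ≠ 0 ∧
      ‖(complexMGF id M w)⁻¹‖ ≤ c * (rexp (-γ * w.re) + rexp ((γ - 1) * w.re)) := by
  obtain ⟨c, hc, γ, hγ, h⟩ := exists_lower_bound_complexMGF hM hM0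
  refine ⟨c⁻¹, inv_pos.2 hc, γ, hγ, fun w hw => ?_⟩
  have h1 := h w hw
  have hpos : 0 < c * min (rexp (γ * w.re)) (rexp ((1 - γ) * w.re)) := by positivity
  refine ⟨norm_pos_iff.1 (hpos.trans_le h1), ?_⟩
  rw [norm_inv]
  refine (inv_anti₀ hpos h1).trans ?_
  rw [mul_inv]
  have e1 : rexp (-γ * w.re) = (rexp (γ * w.re))⁻¹ := by rw [← exp_neg]; ring_nf
  have e2 : rexp ((γ - 1) * w.re) = (rexp ((1 - γ) * w.re))⁻¹ := by rw [← exp_neg]; ring_nf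
  rw [e1, e2]
  gcongr
  rcases min_choice (rexp (γ * w.re)) (rexp ((1 - γ) * w.re)) with h | h <;> rw [h]
  · exact le_add_of_nonneg_right (by positivity)
  · exact le_add_of_nonneg_left (by positivity)

omit [IsFiniteMeasure M] in
lemma complexMGF_conj (w : ℂ) :
    complexMGF id M (starRingEnd ℂ w) = starRingEnd ℂ (complexMGF id M w) := by
  rw [complexMGF, complexMGF, ← integral_conj]
  refine integral_congr_ae (ae_of_all _ fun α => ?_)
  simp [← Complex.exp_conj]

/-- The imaginary jump of `1 / ∫ z ^ α dM(α)` across the negative half-line, in the logarithmic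
coordinate. -/
noncomputable def logJump (M : Measure ℝ) (x : ℝ) : ℝ :=
  -((complexMGF id M (x + π * Complex.I))⁻¹).im

lemma continuous_logJump (hM : ∀ᵐ α ∂M, α ∈ Ioo (0:ℝ) 1) (hM0 : M ≠ 0) :
    Continuous (logJump M) := by
  obtain ⟨c, hc, γ, hγ, h⟩ := exists_norm_inv_complexMGF_le hM hM0
  have h1 : Continuous fun x : ℝ => complexMGF id M (x + π * Complex.I) :=
    (differentiable_complexMGF_of_ae_mem_Ioo hM).continuous.comp (by fun_prop)
  exact (Complex.continuous_im.comp (h1.inv₀ fun x => (h _ (by simp [abs_of_pos pi_pos])).1)).neg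

lemma logJump_nonneg (hM : ∀ᵐ α ∂M, α ∈ Ioo (0:ℝ) 1) (x : ℝ) : 0 ≤ logJump M x := by
  rw [logJump, Complex.inv_im, neg_div, neg_neg]
  refine div_nonneg ?_ (Complex.normSq_nonneg _)
  have := integral_im (integrable_cexp_mul_of_ae_mem_Ioo hM (x + π * Complex.I))
  simp only [RCLike.im_to_complex] at this
  change 0 ≤ (∫ α : ℝ, Complex.exp ((x + π * Complex.I) * α) ∂M).im
  rw [← this]
  refine integral_nonneg_of_ae ?_
  filter_upwards [hM] with α hα
  rw [Complex.exp_im]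
  refine mul_nonneg (exp_pos _).le ?_
  simp only [Complex.mul_im, Complex.add_re, Complex.add_im, Complex.ofReal_re, Complex.ofReal_im,
    Complex.mul_re, Complex.I_re, Complex.I_im]
  refine sin_nonneg_of_nonneg_of_le_pi ?_ ?_ <;> nlinarith [pi_pos, hα.1, hα.2]

lemma cauchyKernel_ne {p : ℝ} (hp : 0 < p) {w : ℂ} (hw : |w.im| ≤ π) (hne : w ≠ Real.log p) :
    Complex.exp w ≠ p := by
  intro h
  rw [← Real.exp_log hp, Complex.ofReal_exp, Complex.exp_eq_exp_iff_exists_int] at h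
  obtain ⟨n, hn⟩ := h
  have him : w.im = n * (2 * π) := by rw [hn]; simp
  have hn0 : n = 0 := by
    rw [him, abs_mul, abs_of_pos (by positivity : 0 < 2 * π)] at hw
    have h1 : |(n:ℝ)| < 1 := by
      by_contra! h2
      nlinarith [pi_pos]
    have h2 : |n| < 1 := by exact_mod_cast h1
    exact Int.abs_lt_one_iff.1 h2
  apply hne
  rw [hn, hn0]; simp

/-- The Cauchy integrand of `1 / P` for the point `p`, in the logarithmic coordinate, with its
singularity removed. -/
lemma exists_differentiableOn_cauchy {F : ℂ → ℂ} {p : ℝ} (hp : 0 < p)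
    (hF : DifferentiableOn ℂ F {w | |w.im| ≤ π}) :
    ∃ h : ℂ → ℂ, DifferentiableOn ℂ h {w | |w.im| ≤ π} ∧
      ∀ w : ℂ, |w.im| ≤ π → w ≠ Real.log p →
        h w = (F w - F (Real.log p)) * (Complex.exp w / (Complex.exp w - p)) := by
  set w0 : ℂ := ((Real.log p : ℝ) : ℂ) with hw0
  have hexp0 : Complex.exp w0 = p := by rw [hw0, ← Complex.ofReal_exp, Real.exp_log hp]
  have hnhds : {w : ℂ | |w.im| ≤ π} ∈ 𝓝 w0 := by
    have : Continuous fun w : ℂ => |w.im| := by fun_prop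
    filter_upwards [this.continuousAt.eventually_lt continuousAt_const
      (show |w0.im| < π by simp [hw0, pi_pos])] with w hw using hw.le
  have d1 := (Complex.differentiableOn_dslope hnhds).2 hF
  have d2 := (Complex.differentiableOn_dslope hnhds).2
    (Complex.differentiable_exp.differentiableOn (s := {w : ℂ | |w.im| ≤ π}))
  refine ⟨fun w => dslope F w0 w * Complex.exp w / dslope Complex.exp w0 w, ?_, ?_⟩
  · refine (d1.mul Complex.differentiable_exp.differentiableOn).div d2 fun w hw => ?_
    rcases eq_or_ne w w0 with rfl | hne
    · rw [dslope_same, Complex.deriv_exp]; exact Complex.exp_ne_zero _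
    · rw [dslope_of_ne _ hne, slope_def_field, hexp0]
      exact div_ne_zero (sub_ne_zero.2 (cauchyKernel_ne hp hw hne)) (sub_ne_zero.2 hne)
  · intro w hw hne
    have h1 : Complex.exp w - p ≠ 0 := sub_ne_zero.2 (cauchyKernel_ne hp hw hne)
    have h2 : w - w0 ≠ 0 := sub_ne_zero.2 hne
    simp only
    rw [dslope_of_ne _ hne, dslope_of_ne _ hne, slope_def_field, slope_def_field, hexp0]
    field_simp

lemma tendsto_intervalIntegral_vertical {h : ℂ → ℂ} {l : Filter ℝ} {L : ℂ} {b : ℝ → ℝ}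
    (hd : ContinuousOn h {w | |w.im| ≤ π})
    (hb : ∀ᶠ R : ℝ in l, ∀ y : ℝ, |y| ≤ π → ‖h (R + y * Complex.I) - L‖ ≤ b R)
    (hb0 : Tendsto b l (𝓝 0)) :
    Tendsto (fun R : ℝ => ∫ y in -π..π, h (R + y * Complex.I)) l (𝓝 (2 * π * L)) := by
  rw [tendsto_iff_norm_sub_tendsto_zero]
  refine squeeze_zero' (Eventually.of_forall fun _ => norm_nonneg _) ?_
    (by simpa using hb0.mul_const (2 * π))
  filter_upwards [hb] with R hR
  have hi : IntervalIntegrable (fun y : ℝ => h (R + y * Complex.I)) volume (-π) π := by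
    refine ContinuousOn.intervalIntegrable (hd.comp (by fun_prop) fun y hy => ?_)
    rw [uIcc_of_le (by linarith [pi_pos])] at hy
    simpa using abs_le.2 hy
  have e : (∫ y in -π..π, h (R + y * Complex.I)) - 2 * π * L
      = ∫ y in -π..π, (h (R + y * Complex.I) - L) := by
    rw [intervalIntegral.integral_sub hi (by simp)]
    simp only [intervalIntegral.integral_const, sub_neg_eq_add, Complex.real_smul]
    push_cast
    ring
  rw [e]
  refine (intervalIntegral.norm_integral_le_of_norm_le_const (C := b R) fun y hy => ?_).trans ?_
  · rw [uIoc_of_le (by linarith [pi_pos])] at hy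
    exact hR y (abs_le.2 ⟨hy.1.le, hy.2⟩)
  · rw [sub_neg_eq_add, ← two_mul, abs_of_pos (by positivity)]

lemma tendsto_exp_mul_atTop_nhds_zero {a : ℝ} (ha : a < 0) :
    Tendsto (fun R : ℝ => rexp (a * R)) atTop (𝓝 0) :=
  tendsto_exp_atBot.comp (tendsto_id.const_mul_atTop_of_neg ha)

/-- Stieltjes representation of `1 / ∫ p ^ α dM(α)`. -/
lemma integral_logJump (hM : ∀ᵐ α ∂M, α ∈ Ioo (0:ℝ) 1) (hM0 : M ≠ 0) {p : ℝ} (hp : 0 < p) :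
    Integrable (fun x => logJump M x * (rexp x / (rexp x + p))) ∧
      ∫ x, logJump M x * (rexp x / (rexp x + p)) = π / mgf id M (Real.log p) := by
  obtain ⟨c, hc, γ, hγ, hF⟩ := exists_norm_inv_complexMGF_le hM hM0
  set F : ℂ → ℂ := fun w => (complexMGF id M w)⁻¹ with hFdef
  set F0 : ℂ := F (Real.log p : ℝ) with hF0
  have hF0' : F0 = ((mgf id M (Real.log p))⁻¹ : ℝ) := by
    rw [hF0, hFdef]; simp only; rw [complexMGF_ofReal]; push_cast; rfl
  have hFd : DifferentiableOn ℂ F {w | |w.im| ≤ π} :=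
    (differentiable_complexMGF_of_ae_mem_Ioo hM).differentiableOn.inv fun w hw => (hF w hw).1
  obtain ⟨h, hd, hh⟩ := exists_differentiableOn_cauchy hp hFd
  have key : ∀ R : ℝ, Real.log p < R → ∀ y : ℝ, |y| ≤ π →
      h (R + y * Complex.I) - (-F0) = (F (R + y * Complex.I)
        + (F (R + y * Complex.I) - F0) * (p / (Complex.exp (R + y * Complex.I) - p))) := by
    intro R hR y hy
    have hy' : |((R : ℂ) + y * Complex.I).im| ≤ π := by simpa using hy
    have hne : (R : ℂ) + y * Complex.I ≠ Real.log p := fun h => by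
      have := congrArg Complex.re h
      simp at this
      linarith
    rw [hh _ hy' hne]
    have := sub_ne_zero.2 (cauchyKernel_ne hp hy' hne)
    field_simp
    ring
  have hright : Tendsto (fun R : ℝ => ∫ y in -π..π, h (R + y * Complex.I)) atTop
      (𝓝 (2 * π * (-F0))) := by
    refine tendsto_intervalIntegral_vertical (b := fun R =>
      c * (rexp (-γ * R) + rexp ((γ - 1) * R)) +
        (c * (rexp (-γ * R) + rexp ((γ - 1) * R)) + ‖F0‖) * (p / (rexp R - p)))
      hd.continuousOn ?_ ?_
    · filter_upwards [eventually_gt_atTop (Real.log p)] with R hR y hy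
      rw [key R hR y hy]
      have h1 := (hF (R + y * Complex.I) (by simpa using hy)).2
      have hre : ((R : ℂ) + y * Complex.I).re = R := by simp
      rw [hre] at h1
      have hlt : p < rexp R := by rwa [← Real.log_lt_iff_lt_exp hp]
      have h2 : ‖(p : ℂ) / (Complex.exp (R + y * Complex.I) - p)‖ ≤ p / (rexp R - p) := by
        rw [norm_div, Complex.norm_of_nonneg hp.le]
        refine div_le_div_of_nonneg_left hp.le (sub_pos.2 hlt) ?_
        have := norm_sub_norm_le (Complex.exp (R + y * Complex.I)) p
        rwa [Complex.norm_exp, hre, Complex.norm_of_nonneg hp.le] at this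
      refine (norm_add_le _ _).trans (add_le_add h1 ?_)
      rw [norm_mul]
      exact mul_le_mul ((norm_sub_le _ _).trans (by gcongr)) h2 (norm_nonneg _)
        (add_nonneg (by positivity) (norm_nonneg _))
    · have t1 : Tendsto (fun R : ℝ => c * (rexp (-γ * R) + rexp ((γ - 1) * R))) atTop (𝓝 0) := by
        simpa using ((tendsto_exp_mul_atTop_nhds_zero (neg_neg_of_pos hγ.1)).add
          (tendsto_exp_mul_atTop_nhds_zero (show γ - 1 < 0 by linarith [hγ.2]))).const_mul c
      have t2 : Tendsto (fun R : ℝ => p / (rexp R - p)) atTop (𝓝 0) :=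
        (tendsto_atTop_add_const_right _ (-p) tendsto_exp_atTop).const_div_atTop p
      simpa using t1.add ((t1.add_const ‖F0‖).mul t2)
  have hleft : Tendsto (fun R : ℝ => ∫ y in -π..π, h ((-R : ℝ) + y * Complex.I)) atTop (𝓝 0) := by
    have : Tendsto (fun R : ℝ => ∫ y in -π..π, h (R + y * Complex.I)) atBot (𝓝 (2 * π * 0)) := by
      refine tendsto_intervalIntegral_vertical (b := fun R =>
        (c * (rexp ((1 - γ) * R) + rexp (γ * R)) + ‖F0‖ * rexp R) / (p - rexp R))
        hd.continuousOn ?_ ?_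
      · filter_upwards [eventually_lt_atBot (Real.log p)] with R hR y hy
        have hy' : |((R : ℂ) + y * Complex.I).im| ≤ π := by simpa using hy
        have hre : ((R : ℂ) + y * Complex.I).re = R := by simp
        have hne : (R : ℂ) + y * Complex.I ≠ Real.log p := fun h => by
          have := congrArg Complex.re h
          rw [hre] at this
          simp at this
          linarith
        have h1 := (hF (R + y * Complex.I) hy').2
        rw [hre] at h1
        have hlt : rexp R < p := by rwa [← Real.lt_log_iff_exp_lt hp]
        rw [sub_zero, hh _ hy' hne, norm_mul, norm_div, ← mul_div_assoc]
        have h3 := norm_sub_norm_le (p : ℂ) (Complex.exp (R + y * Complex.I))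
        rw [norm_sub_rev, Complex.norm_exp, hre, Complex.norm_of_nonneg hp.le] at h3
        refine div_le_div₀ (by positivity) ?_ (sub_pos.2 hlt) h3
        rw [Complex.norm_exp, hre]
        have e : c * (rexp ((1 - γ) * R) + rexp (γ * R)) + ‖F0‖ * rexp R
            = (c * (rexp (-γ * R) + rexp ((γ - 1) * R)) + ‖F0‖) * rexp R := by
          have e1 : rexp ((1 - γ) * R) = rexp (-γ * R) * rexp R := by rw [← exp_add]; ring_nf
          have e2 : rexp (γ * R) = rexp ((γ - 1) * R) * rexp R := by rw [← exp_add]; ring_nf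
          rw [e1, e2]; ring
        rw [e]
        gcongr
        exact (norm_sub_le _ _).trans (by gcongr)
      · have t : ∀ a : ℝ, 0 < a → Tendsto (fun R : ℝ => rexp (a * R)) atBot (𝓝 0) := fun a ha =>
          tendsto_exp_atBot.comp (tendsto_id.const_mul_atBot ha)
        have := ((((t (1 - γ) (by linarith [hγ.2])).add (t γ hγ.1)).const_mul c).add
          (tendsto_exp_atBot.const_mul ‖F0‖)).div (tendsto_exp_atBot.const_sub p)
          (by simpa using hp.ne')
        rw [show (c * (0 + 0) + ‖F0‖ * 0) / (p - 0) = 0 by simp] at this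
        exact this
    rw [mul_zero] at this
    exact this.comp tendsto_neg_atTop_atBot
  have hjump : ∀ x : ℝ, h (x + (-π : ℝ) * Complex.I) - h (x + π * Complex.I)
      = 2 * Complex.I * ((logJump M x * (rexp x / (rexp x + p)) : ℝ) : ℂ) := by
    intro x
    have hne : ∀ y : ℝ, y ≠ 0 → (x : ℂ) + y * Complex.I ≠ Real.log p := fun y hy h => by
      have := congrArg Complex.im h
      simp at this
      exact hy this
    have him : ∀ y : ℝ, ((x : ℂ) + y * Complex.I).im = y := fun y => by simp
    have hexp : Complex.exp (x + π * Complex.I) = -(rexp x : ℂ) := by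
      rw [Complex.exp_add, Complex.exp_pi_mul_I]; simp
    have hexp' : Complex.exp (x + (-π : ℝ) * Complex.I) = -(rexp x : ℂ) := by
      rw [Complex.exp_add, Complex.ofReal_neg, neg_mul, Complex.exp_neg, Complex.exp_pi_mul_I]; simp
    have hconj : F (x + (-π : ℝ) * Complex.I) = starRingEnd ℂ (F (x + π * Complex.I)) := by
      rw [hFdef]; simp only; rw [map_inv₀, ← complexMGF_conj]; simp
    rw [hh _ (by rw [him, abs_neg, abs_of_pos pi_pos]) (hne _ (neg_ne_zero.2 pi_ne_zero)),
      hh _ (by rw [him, abs_of_pos pi_pos]) (hne _ pi_ne_zero), hexp, hexp', hconj, ← sub_mul,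
      sub_sub_sub_cancel_right, ← neg_sub (F _), Complex.sub_conj]
    have e : -(rexp x : ℂ) / (-(rexp x : ℂ) - p) = ((rexp x / (rexp x + p) : ℝ) : ℂ) := by
      push_cast
      rw [← neg_div_neg_eq]; congr 1 <;> ring
    rw [e]
    simp only [logJump]
    push_cast
    ring
  have hcont : Continuous (fun x => logJump M x * (rexp x / (rexp x + p))) :=
    (continuous_logJump hM hM0).mul (continuous_exp.div (by fun_prop) fun x => by positivity)
  have hrect : ∀ R : ℝ, ∫ x in -R..R, logJump M x * (rexp x / (rexp x + p))
      = (-(1 / 2) * ((∫ y in -π..π, h (R + y * Complex.I))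
          - ∫ y in -π..π, h ((-R : ℝ) + y * Complex.I))).re := by
    intro R
    have hcx : ∀ y : ℝ, |y| ≤ π →
        IntervalIntegrable (fun x : ℝ => h (x + y * Complex.I)) volume (-R) R := fun y hy =>
      (hd.continuousOn.comp_continuous (by fun_prop) fun x => by
        simpa using hy).intervalIntegrable _ _
    have h1 := Complex.integral_boundary_rect_eq_zero_of_differentiableOn h
      ((-R : ℝ) + (-π : ℝ) * Complex.I) (R + π * Complex.I) (hd.mono fun w hw => ?_)
    · have r1 : ∀ a b : ℝ, ((a : ℂ) + b * Complex.I).re = a := fun a b => by simp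
      have r2 : ∀ a b : ℝ, ((a : ℂ) + b * Complex.I).im = b := fun a b => by simp
      rw [r1, r1, r2, r2, ← intervalIntegral.integral_sub
        (hcx _ (by rw [abs_neg, abs_of_pos pi_pos])) (hcx _ (by rw [abs_of_pos pi_pos]))] at h1
      simp_rw [hjump] at h1
      rw [intervalIntegral.integral_const_mul, intervalIntegral.integral_ofReal, smul_eq_mul,
        smul_eq_mul] at h1
      rw [← Complex.ofReal_re (∫ x in -R..R, logJump M x * (rexp x / (rexp x + p)))]
      congr 1
      have h2 : (2 * Complex.I) * (((∫ x in -R..R, logJump M x * (rexp x / (rexp x + p)) : ℝ) : ℂ) -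
        (-(1 / 2) * ((∫ y in -π..π, h (R + y * Complex.I))
          - ∫ y in -π..π, h ((-R : ℝ) + y * Complex.I)))) = 0 := by
        rw [← h1]; ring
      exact sub_eq_zero.1 ((mul_eq_zero.1 h2).resolve_left (by simp))
    · have := hw.2
      simp only [mem_preimage, Complex.add_im, Complex.ofReal_im, Complex.mul_im, Complex.I_im,
        Complex.I_re, Complex.ofReal_re, mul_one, mul_zero, add_zero, zero_add] at this
      rw [uIcc_of_le (by linarith [pi_pos])] at this
      exact abs_le.2 this
  have hlim : Tendsto (fun R : ℝ => ∫ x in -R..R, logJump M x * (rexp x / (rexp x + p))) atTop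
      (𝓝 (π / mgf id M (Real.log p))) := by
    simp_rw [hrect]
    have := (Complex.continuous_re.tendsto _).comp ((hright.sub hleft).const_mul (-(1/2)))
    have e : -(1 / 2) * (2 * (π : ℂ) * -F0 - 0) = ((π / mgf id M (Real.log p) : ℝ) : ℂ) := by
      rw [hF0']; push_cast; ring
    rw [e, Complex.ofReal_re] at this
    exact this
  have hint : Integrable (fun x => logJump M x * (rexp x / (rexp x + p))) := by
    refine integrable_of_intervalIntegral_norm_tendsto (π / mgf id M (Real.log p))
      (fun R => hcont.integrableOn_Ioc) tendsto_neg_atTop_atBot tendsto_id ?_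
    refine hlim.congr fun R => ?_
    refine intervalIntegral.integral_congr fun x _ => ?_
    exact (Real.norm_of_nonneg (mul_nonneg (logJump_nonneg hM x) (by positivity))).symm
  exact ⟨hint, tendsto_nhds_unique
    (intervalIntegral_tendsto_integral hint tendsto_neg_atTop_atBot tendsto_id) hlim⟩

end UnitInterval

section LaplaceConvolution

open scoped ENNReal

/-- Finite measures on `ℝ` whose Laplace transforms are finite and coincide near the origin
are equal. -/
lemma ext_of_lintegral_exp {N₁ N₂ : Measure ℝ}
    (hfin : ∀ x < (1:ℝ), ∫⁻ t, ENNReal.ofReal (rexp (x * t)) ∂N₁ ≠ ∞)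
    (h : ∀ x < (1:ℝ), ∫⁻ t, ENNReal.ofReal (rexp (x * t)) ∂N₁
      = ∫⁻ t, ENNReal.ofReal (rexp (x * t)) ∂N₂) : N₁ = N₂ := by
  have f1 : IsFiniteMeasure N₁ := ⟨by simpa [lt_top_iff_ne_top] using hfin 0 one_pos⟩
  have f2 : IsFiniteMeasure N₂ := ⟨by
    have := hfin 0 one_pos
    rw [h 0 one_pos] at this
    simpa [lt_top_iff_ne_top] using this⟩
  have hi : ∀ N : Measure ℝ, (∀ x < (1:ℝ), ∫⁻ t, ENNReal.ofReal (rexp (x * t)) ∂N ≠ ∞) →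
      Iio 1 ⊆ interior (integrableExpSet id N) := fun N hN =>
    interior_maximal (fun x hx => (lintegral_ofReal_ne_top_iff_integrable
      (by fun_prop) (ae_of_all _ fun t => (exp_pos _).le)).1 (hN x hx)) isOpen_Iio
  have hi1 := hi N₁ hfin
  have hi2 := hi N₂ fun x hx => h x hx ▸ hfin x hx
  have hmgf : ∀ x < (1:ℝ), mgf id N₁ x = mgf id N₂ x := fun x hx => by
    have e : ∀ N : Measure ℝ, mgf id N x = (∫⁻ t, ENNReal.ofReal (rexp (x * t)) ∂N).toReal :=
      fun N => integral_eq_lintegral_of_nonneg_ae (ae_of_all _ fun t => (exp_pos _).le)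
        (by fun_prop)
    rw [e, e, h x hx]
  have hEq : EqOn (complexMGF id N₁) (complexMGF id N₂) {z | z.re ∈ Iio (1:ℝ)} := by
    refine AnalyticOnNhd.eqOn_of_preconnected_of_frequently_eq (z₀ := 0)
      (analyticOnNhd_complexMGF.mono fun z hz => hi1 hz)
      (analyticOnNhd_complexMGF.mono fun z hz => hi2 hz)
      (((convex_Iio (1:ℝ)).linear_preimage Complex.reLm).isPreconnected) (by simp) ?_
    have hr : ∃ᶠ x : ℝ in 𝓝[≠] 0, complexMGF id N₁ x = complexMGF id N₂ x := by
      refine Eventually.frequently ?_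
      filter_upwards [nhdsWithin_le_nhds (Iio_mem_nhds one_pos)] with x hx
      rw [complexMGF_ofReal, complexMGF_ofReal, hmgf x hx]
    have ht : Tendsto (fun x : ℝ => (x : ℂ)) (𝓝[≠] 0) (𝓝[≠] 0) := by
      refine tendsto_nhdsWithin_iff.2 ⟨?_, ?_⟩
      · exact (Complex.continuous_ofReal.tendsto' 0 0 (by simp)).mono_left nhdsWithin_le_nhds
      · filter_upwards [self_mem_nhdsWithin] with x hx
        simpa using hx
    exact ht.frequently hr
  refine Measure.ext_of_charFun (funext fun t => ?_)
  rw [← complexMGF_id_mul_I, ← complexMGF_id_mul_I]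
  exact hEq (by simp)

lemma lintegral_exp_mul_conv {K G : ℝ → ℝ≥0∞} (hK : Measurable K) (hG : Measurable G) (p : ℝ) :
    ∫⁻ t, ENNReal.ofReal (rexp (-p * t)) * ∫⁻ s, K (t - s) * G s
      = (∫⁻ t, ENNReal.ofReal (rexp (-p * t)) * K t)
        * ∫⁻ t, ENNReal.ofReal (rexp (-p * t)) * G t := by
  have e1 : ∀ t, ENNReal.ofReal (rexp (-p * t)) * ∫⁻ s, K (t - s) * G s
      = ∫⁻ s, (ENNReal.ofReal (rexp (-p * (t - s))) * K (t - s)) *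
        (ENNReal.ofReal (rexp (-p * s)) * G s) := fun t => by
    rw [← lintegral_const_mul _ (by fun_prop)]
    refine lintegral_congr fun s => ?_
    have : rexp (-p * t) = rexp (-p * (t - s)) * rexp (-p * s) := by rw [← exp_add]; ring_nf
    rw [this, ENNReal.ofReal_mul (exp_pos _).le]
    ring
  simp_rw [e1]
  rw [lintegral_lintegral_swap (by fun_prop), ← lintegral_const_mul _ (by fun_prop)]
  refine lintegral_congr fun s => ?_
  rw [lintegral_mul_const _ (by fun_prop), lintegral_sub_right_eq_self
    (fun t => ENNReal.ofReal (rexp (-p * t)) * K t) s]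

lemma conv_eq_mul_lintegral {K G : ℝ → ℝ≥0∞} {t : ℝ} (ht : 0 < t) :
    ∫⁻ s, K (t - s) * G s = ENNReal.ofReal t * ∫⁻ x, K (t * (1 - x)) * G (t * x) := by
  have h := lintegral_image_eq_lintegral_abs_deriv_mul (s := univ) (f := fun x => t * x)
    (f' := fun _ => t) MeasurableSet.univ
    (fun x _ => (hasDerivAt_const_mul t).hasDerivWithinAt)
    (mul_right_injective₀ ht.ne').injOn (fun s => K (t - s) * G s)
  rw [image_univ_of_surjective (mul_left_surjective₀ ht.ne')] at h
  rw [setLIntegral_univ, setLIntegral_univ] at h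
  rw [h, ← lintegral_const_mul' _ _ ENNReal.ofReal_ne_top, abs_of_pos ht]
  simp_rw [mul_sub, mul_one]

lemma lintegral_exp_neg_Ioi {p : ℝ} (hp : 0 < p) :
    ∫⁻ t in Ioi 0, ENNReal.ofReal (rexp (-p * t)) = ENNReal.ofReal (1 / p) := by
  rw [← ofReal_integral_eq_lintegral_ofReal (integrableOn_exp_mul_Ioi (neg_neg_of_pos hp) 0)
    (ae_of_all _ fun _ => (exp_pos _).le), integral_exp_mul_Ioi (neg_neg_of_pos hp)]
  simp

/-- If the Laplace transforms of two decreasing kernels multiply to `1 / p`, then their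
convolution is identically one. -/
lemma conv_eq_one_of_laplace {K G : ℝ → ℝ≥0∞} (hK : Measurable K) (hG : Measurable G)
    (hK0 : ∀ t ≤ 0, K t = 0) (hG0 : ∀ t ≤ 0, G t = 0)
    (hKa : AntitoneOn K (Ioi 0)) (hGa : AntitoneOn G (Ioi 0))
    (hL : ∀ p > (0:ℝ), (∫⁻ t, ENNReal.ofReal (rexp (-p * t)) * K t)
        * (∫⁻ t, ENNReal.ofReal (rexp (-p * t)) * G t) = ENNReal.ofReal (1 / p))
    {t : ℝ} (ht : 0 < t) : ∫⁻ s, K (t - s) * G s = 1 := by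
  set H : ℝ → ℝ≥0∞ := fun t => ∫⁻ s, K (t - s) * G s with hH
  have hHm : Measurable H := by
    have : Measurable (fun q : ℝ × ℝ => K (q.1 - q.2) * G q.2) := by fun_prop
    exact this.lintegral_prod_right'
  have hprod : ∀ r x : ℝ, 0 < r → x ∉ Ioo (0:ℝ) 1 → K (r * (1 - x)) * G (r * x) = 0 := by
    intro r x hr hx
    rcases le_or_gt x 0 with h | h
    · rw [hG0 _ (mul_nonpos_of_nonneg_of_nonpos hr.le h), mul_zero]
    · have : 1 ≤ x := not_lt.1 fun h' => hx ⟨h, h'⟩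
      rw [hK0 _ (mul_nonpos_of_nonneg_of_nonpos hr.le (by linarith)), zero_mul]
  have hH0 : ∀ t ≤ 0, H t = 0 := fun t ht => by
    rw [hH]
    simp only
    rw [lintegral_eq_zero_iff (by fun_prop)]
    refine ae_of_all _ fun s => ?_
    rcases le_or_gt s 0 with h | h
    · simp [hG0 s h]
    · simp [hK0 (t - s) (by linarith)]
  have hHae : ∀ᵐ s, 0 < s → H s = 1 := by
    set f₁ : ℝ → ℝ≥0∞ := fun t => ENNReal.ofReal (rexp (-1 * t)) * H t with hf₁
    set f₂ : ℝ → ℝ≥0∞ := (Ioi 0).indicator fun t => ENNReal.ofReal (rexp (-1 * t)) with hf₂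
    have m1 : Measurable f₁ := by fun_prop
    have m2 : Measurable f₂ := Measurable.indicator (by fun_prop) measurableSet_Ioi
    have hmul : ∀ x t : ℝ, ENNReal.ofReal (rexp (-1 * t)) * ENNReal.ofReal (rexp (x * t))
        = ENNReal.ofReal (rexp (-(1 - x) * t)) := fun x t => by
      rw [← ENNReal.ofReal_mul (exp_pos _).le, ← exp_add]; ring_nf
    have L1 : ∀ x < (1:ℝ), ∫⁻ t, ENNReal.ofReal (rexp (x * t)) ∂(volume.withDensity f₁)
        = ENNReal.ofReal (1 / (1 - x)) := fun x hx => by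
      rw [lintegral_withDensity_eq_lintegral_mul _ m1 (by fun_prop), ← hL (1 - x) (by linarith),
        ← lintegral_exp_mul_conv hK hG]
      refine lintegral_congr fun t => ?_
      simp only [Pi.mul_apply, hf₁]
      rw [← hmul, mul_right_comm]
    have L2 : ∀ x < (1:ℝ), ∫⁻ t, ENNReal.ofReal (rexp (x * t)) ∂(volume.withDensity f₂)
        = ENNReal.ofReal (1 / (1 - x)) := fun x hx => by
      rw [lintegral_withDensity_eq_lintegral_mul _ m2 (by fun_prop),
        ← lintegral_exp_neg_Ioi (by linarith), ← lintegral_indicator measurableSet_Ioi]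
      refine lintegral_congr fun t => ?_
      by_cases h : t ∈ Ioi (0:ℝ)
      · simp only [Pi.mul_apply, hf₂, indicator_of_mem h, hmul]
      · simp only [Pi.mul_apply, hf₂, indicator_of_notMem h, zero_mul]
    have hN := ext_of_lintegral_exp (fun x hx => (L1 x hx) ▸ ENNReal.ofReal_ne_top)
      (fun x hx => (L1 x hx).trans (L2 x hx).symm)
    filter_upwards [(withDensity_eq_iff_of_sigmaFinite m1.aemeasurable m2.aemeasurable).1 hN]
      with s hs hs0
    simp only [hf₁, hf₂, indicator_of_mem (mem_Ioi.2 hs0)] at hs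
    have hne : ENNReal.ofReal (rexp (-1 * s)) ≠ 0 := (ENNReal.ofReal_pos.2 (exp_pos _)).ne'
    exact (ENNReal.mul_right_inj hne ENNReal.ofReal_ne_top).1 (hs.trans (mul_one _).symm)
  set φ : ℝ → ℝ≥0∞ := fun t => ∫⁻ x, K (t * (1 - x)) * G (t * x) with hφ
  have hφa : ∀ r s : ℝ, 0 < r → r ≤ s → φ s ≤ φ r := fun r s hr hrs => by
    refine lintegral_mono fun x => ?_
    by_cases hx : x ∈ Ioo (0:ℝ) 1
    · have h1 : 0 < 1 - x := by linarith [hx.2]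
      have hs := hr.trans_le hrs
      exact mul_le_mul' (hKa (mul_pos hr h1) (mul_pos hs h1) (by gcongr))
        (hGa (mul_pos hr hx.1) (mul_pos hs hx.1) (mul_le_mul_of_nonneg_right hrs hx.1.le))
    · simp only [hprod s x (hr.trans_le hrs) hx, zero_le]
  have hdense := Measure.dense_of_ae hHae
  have hφeq : ∀ s : ℝ, 0 < s → H s = 1 → φ s = (ENNReal.ofReal s)⁻¹ := fun s hs h1 => by
    have := conv_eq_mul_lintegral (K := K) (G := G) hs
    exact ENNReal.eq_inv_of_mul_eq_one_left (by rw [mul_comm, ← h1]; exact this.symm)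
  have hlim : ∀ l ≤ 𝓝 t, Tendsto (fun s : ℝ => (ENNReal.ofReal s)⁻¹) l
      (𝓝 (ENNReal.ofReal t)⁻¹) := fun l hl =>
    ((continuous_inv.comp ENNReal.continuous_ofReal).tendsto t).mono_left hl
  have hφt : φ t = (ENNReal.ofReal t)⁻¹ := by
    apply le_antisymm
    · refine ge_of_tendsto_of_frequently (hlim (𝓝[<] t) nhdsWithin_le_nhds) fun hev => ?_
      obtain ⟨a, ha, hsub⟩ := (mem_nhdsLT_iff_exists_Ioo_subset).1 hev
      obtain ⟨s, hs, has⟩ := hdense.exists_between (max_lt ht ha : max 0 a < t)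
      have hs0 : 0 < s := (le_max_left _ _).trans_lt has.1
      exact hsub ⟨(le_max_right _ _).trans_lt has.1, has.2⟩
        ((hφa s t hs0 has.2.le).trans_eq (hφeq s hs0 (hs hs0)))
    · refine le_of_tendsto_of_frequently (hlim (𝓝[>] t) nhdsWithin_le_nhds) fun hev => ?_
      obtain ⟨a, ha, hsub⟩ := (mem_nhdsGT_iff_exists_Ioo_subset).1 hev
      obtain ⟨s, hs, has⟩ := hdense.exists_between ha
      have hs0 : 0 < s := ht.trans has.1
      exact hsub has ((hφeq s hs0 (hs hs0)).symm.trans_le (hφa t s ht has.1.le))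
  rw [conv_eq_mul_lintegral ht]
  change ENNReal.ofReal t * φ t = 1
  rw [hφt]
  exact ENNReal.mul_inv_cancel (ENNReal.ofReal_pos.2 ht).ne' ENNReal.ofReal_ne_top

end LaplaceConvolution

section Kernels

open scoped ENNReal

variable {M : Measure ℝ} [IsFiniteMeasure M]

/-- The kernel of the distributed-order derivative with order distribution `M`. -/
noncomputable def memoryKernel (M : Measure ℝ) (t : ℝ) : ℝ :=
  ∫ α, t ^ (-α) / Real.Gamma (1 - α) ∂M

/-- The kernel of the fractional integral with order distribution `M`. -/
noncomputable def resolventKernel (M : Measure ℝ) (t : ℝ) : ℝ :=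
  (1 / π) * ∫ r in Ioi (0:ℝ), rexp (-r * t) * logJump M (Real.log r)

lemma continuous_inv_Gamma : Continuous fun x : ℝ => (Real.Gamma x)⁻¹ := by
  have h : (fun x : ℝ => (Real.Gamma x)⁻¹) = fun x : ℝ => ((Complex.Gamma x)⁻¹).re := by
    ext x
    rw [Complex.Gamma_ofReal, ← Complex.ofReal_inv, Complex.ofReal_re]
  rw [h]
  exact Complex.continuous_re.comp
    (Complex.differentiable_one_div_Gamma.continuous.comp Complex.continuous_ofReal)

lemma integrable_memoryKernel (hM : ∀ᵐ α ∂M, α ∈ Ioo (0:ℝ) 1) {t : ℝ} (ht : 0 < t) :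
    Integrable (fun α => t ^ (-α) / Real.Gamma (1 - α)) M := by
  have hc : Continuous fun α : ℝ => (Real.Gamma (1 - α))⁻¹ :=
    continuous_inv_Gamma.comp (by fun_prop)
  obtain ⟨C, hC⟩ := isCompact_Icc.exists_bound_of_continuousOn (hc.continuousOn (s := Icc (0:ℝ) 1))
  have h1 : Integrable (fun α => t ^ (-α)) M := by
    refine (integrable_exp_mul_of_ae_mem_Ioo hM (-Real.log t)).congr (ae_of_all _ fun α => ?_)
    simp only [rpow_def_of_pos ht]; ring_nf
  exact h1.mul_bdd (c := C) hc.aestronglyMeasurable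
    (hM.mono fun α hα => hC α (Ioo_subset_Icc_self hα))

omit [IsFiniteMeasure M] in
lemma memoryKernel_integrand_nonneg (hM : ∀ᵐ α ∂M, α ∈ Ioo (0:ℝ) 1) {t : ℝ} (ht : 0 ≤ t) :
    0 ≤ᵐ[M] fun α => t ^ (-α) / Real.Gamma (1 - α) := by
  filter_upwards [hM] with α hα
  exact div_nonneg (rpow_nonneg ht _) (Gamma_pos_of_pos (by linarith [hα.2])).le

omit [IsFiniteMeasure M] in
lemma memoryKernel_nonneg (hM : ∀ᵐ α ∂M, α ∈ Ioo (0:ℝ) 1) {t : ℝ} (ht : 0 ≤ t) :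
    0 ≤ memoryKernel M t :=
  integral_nonneg_of_ae (memoryKernel_integrand_nonneg hM ht)

lemma measurable_memoryKernel_integrand :
    Measurable fun q : ℝ × ℝ => q.1 ^ (-q.2) / Real.Gamma (1 - q.2) := by
  have h : Measurable fun q : ℝ × ℝ => (Real.Gamma (1 - q.2))⁻¹ :=
    (continuous_inv_Gamma.comp (by fun_prop)).measurable
  exact (measurable_fst.pow measurable_snd.neg).mul h

lemma measurable_memoryKernel : Measurable (memoryKernel M) :=
  measurable_memoryKernel_integrand.stronglyMeasurable.integral_prod_right'.measurable

lemma antitoneOn_memoryKernel (hM : ∀ᵐ α ∂M, α ∈ Ioo (0:ℝ) 1) :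
    AntitoneOn (memoryKernel M) (Ioi 0) := by
  intro s hs t ht hst
  refine integral_mono_ae (integrable_memoryKernel hM ht) (integrable_memoryKernel hM hs) ?_
  filter_upwards [hM] with α hα
  exact div_le_div_of_nonneg_right (rpow_le_rpow_of_nonpos hs hst (by linarith [hα.1]))
    (Gamma_pos_of_pos (by linarith [hα.2])).le

lemma integrableOn_rpow_mul_exp {a t : ℝ} (ha : 0 < a) (ht : 0 < t) :
    IntegrableOn (fun r : ℝ => r ^ (a - 1) * rexp (-(t * r))) (Ioi 0) := by
  by_contra hni
  have h1 := integral_rpow_mul_exp_neg_mul_Ioi ha ht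
  rw [integral_undef hni] at h1
  have := Gamma_pos_of_pos ha
  exact absurd h1 (by positivity)

lemma laplace_memoryKernel (hM : ∀ᵐ α ∂M, α ∈ Ioo (0:ℝ) 1) {p : ℝ} (hp : 0 < p) :
    ∫⁻ t in Ioi 0, ENNReal.ofReal (rexp (-p * t)) * ENNReal.ofReal (memoryKernel M t)
      = ENNReal.ofReal (mgf id M (Real.log p) / p) := by
  have e1 : ∀ t ∈ Ioi (0:ℝ),
      ENNReal.ofReal (rexp (-p * t)) * ENNReal.ofReal (memoryKernel M t)
      = ∫⁻ α, ENNReal.ofReal (rexp (-p * t)) *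
        ENNReal.ofReal (t ^ (-α) / Real.Gamma (1 - α)) ∂M := fun t ht => by
    rw [lintegral_const_mul' _ _ ENNReal.ofReal_ne_top, memoryKernel,
      ofReal_integral_eq_lintegral_ofReal (integrable_memoryKernel hM ht)
        (memoryKernel_integrand_nonneg hM (le_of_lt ht))]
  have hme : Measurable fun q : ℝ × ℝ => ENNReal.ofReal (rexp (-p * q.1)) *
      ENNReal.ofReal (q.1 ^ (-q.2) / Real.Gamma (1 - q.2)) :=
    Measurable.mul (by fun_prop) measurable_memoryKernel_integrand.ennreal_ofReal
  rw [setLIntegral_congr_fun measurableSet_Ioi e1, lintegral_lintegral_swap hme.aemeasurable]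
  have e2 : ∀ᵐ α ∂M, ∫⁻ t in Ioi 0, ENNReal.ofReal (rexp (-p * t)) *
        ENNReal.ofReal (t ^ (-α) / Real.Gamma (1 - α))
      = ENNReal.ofReal (rexp (Real.log p * α) / p) := by
    filter_upwards [hM] with α hα
    have hα1 : 0 < 1 - α := by linarith [hα.2]
    have hΓ := Gamma_pos_of_pos hα1
    have h1 := integral_rpow_mul_exp_neg_mul_Ioi hα1 hp
    have hi := integrableOn_rpow_mul_exp hα1 hp
    have h2 : ∫⁻ t in Ioi 0, ENNReal.ofReal (rexp (-p * t)) *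
        ENNReal.ofReal (t ^ (-α) / Real.Gamma (1 - α))
      = ∫⁻ t in Ioi 0, ENNReal.ofReal
        (t ^ ((1 - α) - 1) * rexp (-(p * t)) / Real.Gamma (1 - α)) := by
      refine setLIntegral_congr_fun measurableSet_Ioi fun t _ => ?_
      rw [← ENNReal.ofReal_mul (exp_pos _).le]
      congr 1
      rw [show 1 - α - 1 = -α by ring, neg_mul]; ring
    rw [h2, ← ofReal_integral_eq_lintegral_ofReal (hi.div_const _), integral_div, h1,
      mul_div_assoc, div_self hΓ.ne', mul_one, one_div, inv_rpow hp.le, ← rpow_neg hp.le,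
      neg_sub, rpow_sub_one hp.ne', rpow_def_of_pos hp]
    filter_upwards [ae_restrict_mem measurableSet_Ioi] with t ht
    have : 0 ≤ t ^ (1 - α - 1) := rpow_nonneg (le_of_lt ht) _
    positivity
  rw [lintegral_congr_ae e2, ← ofReal_integral_eq_lintegral_ofReal
    ((integrable_exp_mul_of_ae_mem_Ioo hM _).div_const _) (ae_of_all _ fun _ => by positivity),
    integral_div]
  rfl

lemma exists_logJump_log_le (hM : ∀ᵐ α ∂M, α ∈ Ioo (0:ℝ) 1) (hM0 : M ≠ 0) :
    ∃ c > 0, ∃ γ ∈ Ioo (0:ℝ) (1/2), ∀ r > 0,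
      logJump M (Real.log r) ≤ c * (r ^ (-γ) + r ^ (γ - 1)) := by
  obtain ⟨c, hc, γ, hγ, h⟩ := exists_norm_inv_complexMGF_le hM hM0
  refine ⟨c, hc, γ, hγ, fun r hr => ?_⟩
  have h1 := (h (Real.log r + π * Complex.I) (by simp [abs_of_pos pi_pos])).2
  rw [show ((Real.log r : ℂ) + π * Complex.I).re = Real.log r by simp] at h1
  rw [rpow_def_of_pos hr, rpow_def_of_pos hr, mul_comm (Real.log r), mul_comm (Real.log r)]
  exact (neg_le_abs _).trans ((Complex.abs_im_le_norm _).trans h1)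

lemma measurable_logJump_log (hM : ∀ᵐ α ∂M, α ∈ Ioo (0:ℝ) 1) (hM0 : M ≠ 0) :
    Measurable fun r => logJump M (Real.log r) :=
  (continuous_logJump hM hM0).measurable.comp Real.measurable_log

lemma resolventKernel_bounds (hM : ∀ᵐ α ∂M, α ∈ Ioo (0:ℝ) 1) (hM0 : M ≠ 0) :
    (∀ t > 0, IntegrableOn (fun r => rexp (-r * t) * logJump M (Real.log r)) (Ioi 0)) ∧
    ∃ c > 0, ∃ γ ∈ Ioo (0:ℝ) (1/2), ∀ t > 0,
      resolventKernel M t ≤ c * max (t ^ (γ - 1)) (t ^ (-γ)) := by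
  obtain ⟨c, hc, γ, hγ, h⟩ := exists_logJump_log_le hM hM0
  have hγ1 : 0 < 1 - γ := by linarith [hγ.2]
  have hdom : ∀ t > 0, IntegrableOn (fun r : ℝ => c * (r ^ ((1 - γ) - 1) * rexp (-(t * r))
      + r ^ (γ - 1) * rexp (-(t * r)))) (Ioi 0) := fun t ht =>
    ((integrableOn_rpow_mul_exp hγ1 ht).add (integrableOn_rpow_mul_exp hγ.1 ht)).const_mul c
  have hle : ∀ t : ℝ, ∀ r ∈ Ioi (0:ℝ), rexp (-r * t) * logJump M (Real.log r)
      ≤ c * (r ^ ((1 - γ) - 1) * rexp (-(t * r)) + r ^ (γ - 1) * rexp (-(t * r))) := by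
    intro t r hr
    rw [show 1 - γ - 1 = -γ by ring, ← add_mul, ← mul_assoc, mul_comm, neg_mul, mul_comm r t]
    exact mul_le_mul_of_nonneg_right (h r hr) (exp_pos _).le
  have hi : ∀ t > 0, IntegrableOn (fun r => rexp (-r * t) * logJump M (Real.log r)) (Ioi 0) := by
    intro t ht
    refine (hdom t ht).mono' (Measurable.aestronglyMeasurable
      (Measurable.mul (by fun_prop) (measurable_logJump_log hM hM0))) ?_
    filter_upwards [ae_restrict_mem measurableSet_Ioi] with r hr
    rw [Real.norm_of_nonneg (mul_nonneg (exp_pos _).le (logJump_nonneg hM _))]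
    exact hle t r hr
  have hΓ1 := Gamma_pos_of_pos hγ1
  have hΓ2 := Gamma_pos_of_pos hγ.1
  refine ⟨hi, 1 / π * (c * (Real.Gamma (1 - γ) + Real.Gamma γ)), by positivity, γ, hγ,
    fun t ht => ?_⟩
  have h1 := setIntegral_mono_on (hi t ht) (hdom t ht) measurableSet_Ioi (hle t)
  rw [integral_const_mul, integral_add (integrableOn_rpow_mul_exp hγ1 ht)
    (integrableOn_rpow_mul_exp hγ.1 ht), integral_rpow_mul_exp_neg_mul_Ioi hγ1 ht,
    integral_rpow_mul_exp_neg_mul_Ioi hγ.1 ht, one_div, inv_rpow ht.le, inv_rpow ht.le,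
    ← rpow_neg ht.le, ← rpow_neg ht.le, neg_sub] at h1
  rw [resolventKernel, mul_assoc]
  refine mul_le_mul_of_nonneg_left (h1.trans ?_) (by positivity)
  rw [mul_assoc, add_mul, mul_comm (t ^ (γ - 1)), mul_comm (t ^ (-γ))]
  gcongr
  · exact le_max_left _ _
  · exact le_max_right _ _

lemma resolventKernel_nonneg (hM : ∀ᵐ α ∂M, α ∈ Ioo (0:ℝ) 1) (t : ℝ) :
    0 ≤ resolventKernel M t :=
  mul_nonneg (by positivity)
    (integral_nonneg fun _ => mul_nonneg (exp_pos _).le (logJump_nonneg hM _))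

lemma antitoneOn_resolventKernel (hM : ∀ᵐ α ∂M, α ∈ Ioo (0:ℝ) 1) (hM0 : M ≠ 0) :
    AntitoneOn (resolventKernel M) (Ioi 0) := by
  intro s hs t ht hst
  have hi := (resolventKernel_bounds hM hM0).1
  refine mul_le_mul_of_nonneg_left (setIntegral_mono_on (hi t ht) (hi s hs) measurableSet_Ioi
    fun r hr => mul_le_mul_of_nonneg_right (exp_le_exp.2 ?_) (logJump_nonneg hM _)) (by positivity)
  rw [neg_mul, neg_mul]
  exact neg_le_neg (mul_le_mul_of_nonneg_left hst (le_of_lt hr))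

lemma measurable_resolventKernel_integrand (hM : ∀ᵐ α ∂M, α ∈ Ioo (0:ℝ) 1) (hM0 : M ≠ 0) :
    Measurable fun q : ℝ × ℝ => rexp (-q.2 * q.1) * logJump M (Real.log q.2) :=
  Measurable.mul (by fun_prop) ((measurable_logJump_log hM hM0).comp measurable_snd)

lemma measurable_resolventKernel (hM : ∀ᵐ α ∂M, α ∈ Ioo (0:ℝ) 1) (hM0 : M ≠ 0) :
    Measurable (resolventKernel M) :=
  ((measurable_resolventKernel_integrand hM hM0).stronglyMeasurable.integral_prod_right'
    (ν := volume.restrict (Ioi 0))).measurable.const_mul _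

lemma laplace_resolventKernel (hM : ∀ᵐ α ∂M, α ∈ Ioo (0:ℝ) 1) (hM0 : M ≠ 0) {p : ℝ}
    (hp : 0 < p) :
    ∫⁻ t in Ioi 0, ENNReal.ofReal (rexp (-p * t)) * ENNReal.ofReal (resolventKernel M t)
      = ENNReal.ofReal (1 / mgf id M (Real.log p)) := by
  have hi := (resolventKernel_bounds hM hM0).1
  have e1 : ∀ t ∈ Ioi (0:ℝ),
      ENNReal.ofReal (rexp (-p * t)) * ENNReal.ofReal (resolventKernel M t)
      = ∫⁻ r in Ioi 0, ENNReal.ofReal (1 / π) * ENNReal.ofReal (rexp (-p * t)) *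
        ENNReal.ofReal (rexp (-r * t) * logJump M (Real.log r)) := fun t ht => by
    rw [lintegral_const_mul' _ _ (ENNReal.mul_ne_top ENNReal.ofReal_ne_top ENNReal.ofReal_ne_top),
      resolventKernel, ENNReal.ofReal_mul (by positivity),
      ofReal_integral_eq_lintegral_ofReal (hi t ht) (ae_of_all _ fun r =>
        mul_nonneg (exp_pos _).le (logJump_nonneg hM _))]
    ring
  have hme : Measurable fun q : ℝ × ℝ => ENNReal.ofReal (1 / π) *
      ENNReal.ofReal (rexp (-p * q.1)) *
        ENNReal.ofReal (rexp (-q.2 * q.1) * logJump M (Real.log q.2)) :=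
    Measurable.mul (by fun_prop) (measurable_resolventKernel_integrand hM hM0).ennreal_ofReal
  rw [setLIntegral_congr_fun measurableSet_Ioi e1, lintegral_lintegral_swap hme.aemeasurable]
  have e2 : ∀ r ∈ Ioi (0:ℝ), ∫⁻ t in Ioi 0, ENNReal.ofReal (1 / π) *
      ENNReal.ofReal (rexp (-p * t)) *
        ENNReal.ofReal (rexp (-r * t) * logJump M (Real.log r))
      = ENNReal.ofReal (1 / π * (logJump M (Real.log r) / (r + p))) := fun r hr => by
    have hrp : 0 < r + p := add_pos hr hp
    have hJ := logJump_nonneg hM (Real.log r)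
    have e3 : ∀ t : ℝ, ENNReal.ofReal (1 / π) * ENNReal.ofReal (rexp (-p * t)) *
        ENNReal.ofReal (rexp (-r * t) * logJump M (Real.log r))
        = ENNReal.ofReal (1 / π * logJump M (Real.log r)) *
          ENNReal.ofReal (rexp (-(r + p) * t)) := fun t => by
      rw [← ENNReal.ofReal_mul (by positivity), ← ENNReal.ofReal_mul (by positivity),
        ← ENNReal.ofReal_mul (by positivity)]
      congr 1
      rw [show -(r + p) * t = -p * t + -r * t by ring, exp_add]; ring
    simp_rw [e3]
    rw [lintegral_const_mul' _ _ ENNReal.ofReal_ne_top, lintegral_exp_neg_Ioi hrp,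
      ← ENNReal.ofReal_mul (by positivity)]
    congr 1; ring
  rw [setLIntegral_congr_fun measurableSet_Ioi e2]
  have h := lintegral_image_eq_lintegral_abs_deriv_mul (s := univ) (f := rexp)
    (f' := rexp) MeasurableSet.univ (fun x _ => (Real.hasDerivAt_exp x).hasDerivWithinAt)
    exp_injective.injOn
    (fun r => ENNReal.ofReal (1 / π * (logJump M (Real.log r) / (r + p))))
  rw [image_univ, Real.range_exp, setLIntegral_univ] at h
  obtain ⟨hint, hval⟩ := integral_logJump hM hM0 hp
  have e4 : ∀ x : ℝ, ENNReal.ofReal |rexp x| *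
      ENNReal.ofReal (1 / π * (logJump M (Real.log (rexp x)) / (rexp x + p)))
      = ENNReal.ofReal (1 / π * (logJump M x * (rexp x / (rexp x + p)))) := fun x => by
    rw [← ENNReal.ofReal_mul (abs_nonneg _), abs_exp, Real.log_exp]
    congr 1; ring
  simp_rw [e4] at h
  rw [h, ← ofReal_integral_eq_lintegral_ofReal (hint.const_mul _) (ae_of_all _ fun x => by
    have := logJump_nonneg hM x
    positivity), integral_const_mul, hval]
  congr 1
  field_simp

/-- The two kernels are convolution inverses, up to integration. -/
lemma conv_memoryKernel_resolventKernel (hM : ∀ᵐ α ∂M, α ∈ Ioo (0:ℝ) 1) (hM0 : M ≠ 0)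
    {t : ℝ} (ht : 0 < t) :
    ∫⁻ s, (Ioi 0).indicator (fun x => ENNReal.ofReal (memoryKernel M x)) (t - s) *
      (Ioi 0).indicator (fun x => ENNReal.ofReal (resolventKernel M x)) s = 1 := by
  have hanti : ∀ f : ℝ → ℝ, AntitoneOn f (Ioi 0) →
      AntitoneOn ((Ioi 0).indicator fun x => ENNReal.ofReal (f x)) (Ioi 0) := by
    intro f hf x hx y hy hxy
    rw [indicator_of_mem hx, indicator_of_mem hy]
    exact ENNReal.ofReal_le_ofReal (hf hx hy hxy)
  have hind : ∀ (f : ℝ → ℝ≥0∞) (p : ℝ),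
      ∫⁻ t, ENNReal.ofReal (rexp (-p * t)) * (Ioi 0).indicator f t
        = ∫⁻ t in Ioi 0, ENNReal.ofReal (rexp (-p * t)) * f t := fun f p => by
    rw [← lintegral_indicator measurableSet_Ioi]
    refine lintegral_congr fun t => ?_
    by_cases h : t ∈ Ioi (0:ℝ)
    · simp only [indicator_of_mem h]
    · simp only [indicator_of_notMem h, mul_zero]
  refine conv_eq_one_of_laplace
    (measurable_memoryKernel.ennreal_ofReal.indicator measurableSet_Ioi)
    ((measurable_resolventKernel hM hM0).ennreal_ofReal.indicator measurableSet_Ioi)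
    (fun t ht => indicator_of_notMem (not_lt.2 ht) _)
    (fun t ht => indicator_of_notMem (not_lt.2 ht) _)
    (hanti _ (antitoneOn_memoryKernel hM)) (hanti _ (antitoneOn_resolventKernel hM hM0))
    (fun p hp => ?_) ht
  have hmgf : 0 < mgf id M (Real.log p) := mgf_pos' hM0 (integrable_exp_mul_of_ae_mem_Ioo hM _)
  rw [hind, hind, laplace_memoryKernel hM hp, laplace_resolventKernel hM hM0 hp,
    ← ENNReal.ofReal_mul (by positivity)]
  congr 1
  field_simp

end Kernels

section VolterraInversion

variable {K G v : ℝ → ℝ}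

lemma conv_integral_of_lintegral_eq_one (hK : Measurable K) (hG : Measurable G)
    (hK0 : ∀ t > 0, 0 ≤ K t) (hG0 : ∀ t > 0, 0 ≤ G t)
    (h1 : ∀ t > 0, ∫⁻ s, (Ioi 0).indicator (fun x => ENNReal.ofReal (K x)) (t - s) *
      (Ioi 0).indicator (fun x => ENNReal.ofReal (G x)) s = 1) {s t : ℝ} (hst : s < t) :
    Integrable (fun τ => (Ioi 0).indicator K (t - τ) * (Ioi 0).indicator G (τ - s)) ∧
      ∫ τ, (Ioi 0).indicator K (t - τ) * (Ioi 0).indicator G (τ - s) = 1 := by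
  have hm : Measurable fun τ => (Ioi 0).indicator K (t - τ) * (Ioi 0).indicator G (τ - s) := by
    have := hK.indicator (measurableSet_Ioi (a := (0:ℝ)))
    have := hG.indicator (measurableSet_Ioi (a := (0:ℝ)))
    fun_prop
  have hKn : ∀ x, 0 ≤ (Ioi (0:ℝ)).indicator K x := fun x => indicator_nonneg hK0 x
  have hnn : 0 ≤ fun τ => (Ioi 0).indicator K (t - τ) * (Ioi 0).indicator G (τ - s) :=
    fun τ => mul_nonneg (hKn _) (indicator_nonneg hG0 _)
  have hl : ∫⁻ τ, ENNReal.ofReal ((Ioi 0).indicator K (t - τ) * (Ioi 0).indicator G (τ - s))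
      = 1 := by
    rw [← h1 (t - s) (sub_pos.2 hst), ← lintegral_sub_right_eq_self (fun τ =>
      (Ioi 0).indicator (fun x => ENNReal.ofReal (K x)) (t - s - τ) *
        (Ioi 0).indicator (fun x => ENNReal.ofReal (G x)) τ) s]
    refine lintegral_congr fun τ => ?_
    have hof : ∀ (f : ℝ → ℝ) (x : ℝ), ENNReal.ofReal ((Ioi 0).indicator f x)
        = (Ioi 0).indicator (fun x => ENNReal.ofReal (f x)) x := fun f x =>
      (congrFun (indicator_comp_of_zero (s := Ioi (0:ℝ)) (f := f) ENNReal.ofReal_zero) x).symm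
    rw [ENNReal.ofReal_mul (hKn _), hof, hof, sub_sub_sub_cancel_right]
  refine ⟨(lintegral_ofReal_ne_top_iff_integrable hm.aestronglyMeasurable
    (ae_of_all _ hnn)).1 (by simp [hl]), ?_⟩
  rw [integral_eq_lintegral_of_nonneg_ae (ae_of_all _ hnn) hm.aestronglyMeasurable, hl,
    ENNReal.toReal_one]

/-- Convolving with `G` and then with `K` is integration, when the convolution of `K` and `G` is
identically one. -/
lemma integral_conv_conv (hK : Measurable K) (hG : Measurable G)
    (hK0 : ∀ t > 0, 0 ≤ K t) (hG0 : ∀ t > 0, 0 ≤ G t)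
    (h1 : ∀ t > 0, ∫⁻ s, (Ioi 0).indicator (fun x => ENNReal.ofReal (K x)) (t - s) *
      (Ioi 0).indicator (fun x => ENNReal.ofReal (G x)) s = 1)
    {t : ℝ} (ht : 0 ≤ t) (hv : IntervalIntegrable v volume 0 t) :
    ∫ τ in (0:ℝ)..t, K (t - τ) * ∫ σ in (0:ℝ)..τ, G (τ - σ) * v σ
      = ∫ σ in (0:ℝ)..t, v σ := by
  set a := (Ioi (0:ℝ)).indicator K with ha
  set b := (Ioi (0:ℝ)).indicator G with hb
  set w := (Ioo 0 t).indicator v with hw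
  have hwi : Integrable w := by
    rw [intervalIntegrable_iff_integrableOn_Ioo_of_le ht] at hv
    exact hv.integrable_indicator measurableSet_Ioo
  have ham : Measurable a := hK.indicator measurableSet_Ioi
  have hbm : Measurable b := hG.indicator measurableSet_Ioi
  have ha0 : ∀ x, 0 ≤ a x := fun x => indicator_nonneg hK0 x
  have hb0 : ∀ x, 0 ≤ b x := fun x => indicator_nonneg hG0 x
  have hconv := fun s (hs : s < t) =>
    conv_integral_of_lintegral_eq_one hK hG hK0 hG0 h1 hs
  have hwt : ∀ σ, t ≤ σ → w σ = 0 := fun σ h => indicator_of_notMem (fun h' => h'.2.not_ge h) _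
  have hmeas : AEStronglyMeasurable (fun q : ℝ × ℝ => a (t - q.1) * b (q.1 - q.2) * w q.2)
      (volume.prod volume) :=
    (Measurable.aestronglyMeasurable (by fun_prop)).mul hwi.aestronglyMeasurable.comp_snd
  have hint : Integrable (fun q : ℝ × ℝ => a (t - q.1) * b (q.1 - q.2) * w q.2)
      (volume.prod volume) := by
    refine (integrable_prod_iff' hmeas).2 ⟨ae_of_all _ fun σ => ?_, ?_⟩
    · rcases lt_or_ge σ t with h | h
      · exact (hconv σ h).1.mul_const (w σ)
      · simp [hwt σ h]
    · refine hwi.norm.congr (ae_of_all _ fun σ => ?_)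
      rcases lt_or_ge σ t with h | h
      · simp only [norm_mul, integral_mul_const]
        simp only [Real.norm_of_nonneg (ha0 _), Real.norm_of_nonneg (hb0 _)]
        rw [(hconv σ h).2, one_mul]
      · simp [hwt σ h]
  have hinner : ∀ τ ∈ Ioo 0 t, K (t - τ) * ∫ σ in (0:ℝ)..τ, G (τ - σ) * v σ
      = ∫ σ, a (t - τ) * b (τ - σ) * w σ := by
    intro τ hτ
    rw [intervalIntegral.integral_of_le hτ.1.le, integral_Ioc_eq_integral_Ioo,
      ← integral_indicator measurableSet_Ioo, ← integral_const_mul]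
    refine integral_congr_ae (ae_of_all _ fun σ => ?_)
    simp only
    rw [ha, indicator_of_mem (mem_Ioi.2 (sub_pos.2 hτ.2)), mul_assoc]
    congr 1
    by_cases h : σ ∈ Ioo 0 τ
    · rw [indicator_of_mem h, hb, hw, indicator_of_mem (mem_Ioi.2 (sub_pos.2 h.2)),
        indicator_of_mem (show σ ∈ Ioo 0 t from ⟨h.1, h.2.trans hτ.2⟩)]
    · rw [indicator_of_notMem h]
      rcases le_or_gt σ 0 with h0 | h0
      · rw [hw, indicator_of_notMem (fun h' => h'.1.not_ge h0), mul_zero]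
      · have : τ ≤ σ := not_lt.1 fun h' => h ⟨h0, h'⟩
        rw [hb, indicator_of_notMem (by simpa using this), zero_mul]
  have houter : ∀ τ ∉ Ioo 0 t, ∫ σ, a (t - τ) * b (τ - σ) * w σ = 0 := by
    intro τ hτ
    refine integral_eq_zero_of_ae (ae_of_all _ fun σ => ?_)
    simp only [Pi.zero_apply]
    rcases le_or_gt τ 0 with h0 | h0
    · by_cases h : σ ∈ Ioo 0 t
      · rw [hb, indicator_of_notMem (by simpa using h0.trans h.1.le), mul_zero, zero_mul]
      · rw [hw, indicator_of_notMem h, mul_zero]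
    · have : t ≤ τ := not_lt.1 fun h' => hτ ⟨h0, h'⟩
      rw [ha, indicator_of_notMem (by simpa using this), zero_mul, zero_mul]
  rw [intervalIntegral.integral_of_le ht, integral_Ioc_eq_integral_Ioo,
    setIntegral_congr_fun measurableSet_Ioo hinner,
    setIntegral_eq_integral_of_forall_compl_eq_zero houter,
    integral_integral_swap (f := fun τ σ => a (t - τ) * b (τ - σ) * w σ) hint,
    intervalIntegral.integral_of_le ht, integral_Ioc_eq_integral_Ioo,
    ← integral_indicator measurableSet_Ioo]
  refine integral_congr_ae (ae_of_all _ fun σ => ?_)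
  simp only [integral_mul_const]
  rcases lt_or_ge σ t with h | h
  · rw [(hconv σ h).2, one_mul]
  · rw [← hw, hwt σ h, mul_zero]

end VolterraInversion

section Density

variable {μ : ℝ → ℝ}

/-- The order distribution with density `μ` on the unit interval. -/
noncomputable def orderMeasure (μ : ℝ → ℝ) : Measure ℝ :=
  (volume.restrict (Ioo 0 1)).withDensity fun α => ENNReal.ofReal (μ α)

lemma ae_orderMeasure_mem_Ioo (μ : ℝ → ℝ) : ∀ᵐ α ∂(orderMeasure μ), α ∈ Ioo (0:ℝ) 1 :=
  (withDensity_absolutelyContinuous _ _).ae_le (ae_restrict_mem measurableSet_Ioo)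

lemma integral_orderMeasure (hmeas : Measurable μ) (hnn : ∀ α ∈ Icc (0:ℝ) 1, 0 ≤ μ α)
    (f : ℝ → ℝ) : ∫ α, f α ∂(orderMeasure μ) = ∫ α in Ioo (0:ℝ) 1, f α * μ α := by
  rw [orderMeasure, integral_withDensity_eq_integral_toReal_smul hmeas.ennreal_ofReal
    (ae_of_all _ fun _ => ENNReal.ofReal_lt_top)]
  refine setIntegral_congr_fun measurableSet_Ioo fun α hα => ?_
  simp only [smul_eq_mul]
  rw [ENNReal.toReal_ofReal (hnn α (Ioo_subset_Icc_self hα)), mul_comm]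

lemma orderMeasure_ne_zero (hnn : ∀ α ∈ Icc (0:ℝ) 1, 0 ≤ μ α) (hint : IntegrableOn μ (Ioo 0 1))
    (hpos : 0 < ∫ α in Ioo (0:ℝ) 1, μ α) : orderMeasure μ ≠ 0 := by
  intro h
  have h1 := Measure.measure_univ_eq_zero.2 h
  rw [orderMeasure, withDensity_apply _ MeasurableSet.univ, Measure.restrict_univ,
    ← ofReal_integral_eq_lintegral_ofReal hint] at h1
  · exact (ENNReal.ofReal_pos.2 hpos).ne' h1
  · filter_upwards [ae_restrict_mem measurableSet_Ioo] with α hα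
    exact hnn α (Ioo_subset_Icc_self hα)

lemma kker_eq_memoryKernel (hmeas : Measurable μ) (hnn : ∀ α ∈ Icc (0:ℝ) 1, 0 ≤ μ α) :
    kker μ = memoryKernel (orderMeasure μ) := by
  ext t
  rw [kker, memoryKernel, integral_orderMeasure hmeas hnn]
  simp_rw [div_mul_eq_mul_div]

lemma gker_eq_resolventKernel (hmeas : Measurable μ) (hnn : ∀ α ∈ Icc (0:ℝ) 1, 0 ≤ μ α)
    (hint : IntegrableOn μ (Ioo 0 1)) : gker μ = resolventKernel (orderMeasure μ) := by
  have : IsFiniteMeasure (orderMeasure μ) := isFiniteMeasure_withDensity_ofReal hint.2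
  ext t
  rw [gker, resolventKernel]
  congr 1
  refine setIntegral_congr_fun measurableSet_Ioi fun r hr => ?_
  congr 1
  have hi := integrable_cexp_mul_of_ae_mem_Ioo (ae_orderMeasure_mem_Ioo μ)
    (Real.log r + π * Complex.I)
  have hre := integral_re hi
  have him := integral_im hi
  simp only [RCLike.re_to_complex, RCLike.im_to_complex, Complex.exp_re, Complex.exp_im,
    Complex.mul_re, Complex.mul_im, Complex.add_re, Complex.add_im, Complex.ofReal_re,
    Complex.ofReal_im, Complex.I_re, Complex.I_im, mul_zero, mul_one, sub_zero, add_zero,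
    zero_add] at hre him
  rw [integral_orderMeasure hmeas hnn] at hre him
  have e : ∀ α : ℝ, r ^ α = rexp (Real.log r * α) := fun α => rpow_def_of_pos hr α
  rw [logJump, Complex.inv_im, neg_div, neg_neg, Complex.normSq_apply, ← sq, ← sq]
  simp only [complexMGF, id_eq]
  rw [← hre, ← him]
  simp_rw [e, mul_comm (rexp _)]

end Density

/-- properties of the fractional integration kernel `g`:
nonnegativity, local integrability, the two-sided power estimate, and the
inversion identities `D^(μ) I^(μ) u = u` (a.e., for bounded `u`) and
`I^(μ) D^(μ) u = u - u(0)` (for absolutely continuous `u`). -/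
theorem gker_properties (μ : ℝ → ℝ)
    (hmeas : Measurable μ)
    (hnn : ∀ α ∈ Icc (0:ℝ) 1, 0 ≤ μ α)
    (hint : IntegrableOn μ (Ioo 0 1))
    (hpos : 0 < ∫ α in Ioo (0:ℝ) 1, μ α) :
    (∀ t, 0 ≤ gker μ t) ∧
    LocallyIntegrableOn (gker μ) (Ici 0) ∧
    (∃ c > 0, ∃ γ ∈ Ioo (0:ℝ) (1/2),
      ∀ t > 0, gker μ t ≤ c * max (t ^ (γ - 1)) (t ^ (-γ))) ∧
    (∀ T > 0, ∀ u : ℝ → ℝ, Measurable u →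
      (∃ M : ℝ, ∀ᵐ t ∂(volume.restrict (Ioo 0 T)), |u t| ≤ M) →
      ∀ᵐ t ∂(volume.restrict (Ioo 0 T)),
        HasDerivAt (fun s => ∫ τ in (0:ℝ)..s, kker μ (s - τ) *
            ∫ σ in (0:ℝ)..τ, gker μ (τ - σ) * u σ) (u t) t) ∧
    (∀ T > 0, ∀ u u' : ℝ → ℝ, IntervalIntegrable u' volume 0 T →
      (∀ t ∈ Icc (0:ℝ) T, u t = u 0 + ∫ s in (0:ℝ)..t, u' s) →
      ∀ t ∈ Icc (0:ℝ) T,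
        (∫ s in (0:ℝ)..t, gker μ (t - s) *
          ∫ τ in (0:ℝ)..s, kker μ (s - τ) * u' τ) = u t - u 0) := by
  have hfin : IsFiniteMeasure (orderMeasure μ) := isFiniteMeasure_withDensity_ofReal hint.2
  have hM := ae_orderMeasure_mem_Ioo μ
  have hM0 := orderMeasure_ne_zero hnn hint hpos
  rw [kker_eq_memoryKernel hmeas hnn, gker_eq_resolventKernel hmeas hnn hint]
  have hKm := measurable_memoryKernel (M := orderMeasure μ)
  have hGm := measurable_resolventKernel hM hM0
  have hK0 : ∀ t > 0, 0 ≤ memoryKernel (orderMeasure μ) t := fun t ht =>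
    memoryKernel_nonneg hM (le_of_lt ht)
  have hG0 := resolventKernel_nonneg hM
  have hKG := fun t (ht : (0:ℝ) < t) => conv_memoryKernel_resolventKernel hM hM0 ht
  refine ⟨hG0, ?_, (resolventKernel_bounds hM hM0).2, ?_, ?_⟩
  · have hL := laplace_resolventKernel hM hM0 one_pos
    have hi : IntegrableOn (fun t => rexp (-1 * t) * resolventKernel (orderMeasure μ) t)
        (Ici 0) := by
      rw [integrableOn_Ici_iff_integrableOn_Ioi]
      refine (lintegral_ofReal_ne_top_iff_integrable
        (Measurable.aestronglyMeasurable (by fun_prop))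
        (ae_of_all _ fun t => mul_nonneg (exp_pos _).le (hG0 t))).1 ?_
      simp_rw [ENNReal.ofReal_mul (exp_pos _).le]
      exact hL ▸ ENNReal.ofReal_ne_top
    have := hi.locallyIntegrableOn.continuousOn_mul (g := fun t => rexp t) (by fun_prop)
      isClosed_Ici.isLocallyClosed
    refine this.congr (ae_of_all _ fun t => ?_)
    rw [← mul_assoc, ← exp_add]
    simp
  · rintro T hT u hu ⟨B, hB⟩
    have hui : IntervalIntegrable u volume 0 T := by
      rw [intervalIntegrable_iff_integrableOn_Ioo_of_le hT.le]
      exact Measure.integrableOn_of_bounded (by simp) hu.aestronglyMeasurable hB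
    filter_upwards [ae_restrict_of_ae hui.ae_hasDerivAt_integral,
      ae_restrict_mem measurableSet_Ioo] with t ht htT
    rw [uIcc_of_le hT.le] at ht
    refine (ht (Ioo_subset_Icc_self htT) 0 (left_mem_Icc.2 hT.le)).congr_of_eventuallyEq ?_
    filter_upwards [Ioo_mem_nhds htT.1 htT.2] with s hs
    exact integral_conv_conv hKm hGm hK0 (fun t _ => hG0 t) hKG hs.1.le
      (hui.mono_set (uIcc_subset_uIcc left_mem_uIcc (uIcc_of_le hT.le ▸ Ioo_subset_Icc_self hs)))
  · intro T hT u u' hu' hu t ht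
    rw [hu t ht, add_sub_cancel_left]
    refine integral_conv_conv hGm hKm (fun t _ => hG0 t) hK0 (fun r hr => ?_) ht.1
      (hu'.mono_set (uIcc_subset_uIcc left_mem_uIcc (uIcc_of_le hT.le ▸ ht)))
    rw [← hKG r hr, ← lintegral_sub_left_eq_self _ r]
    refine lintegral_congr fun s => ?_
    rw [sub_sub_cancel, mul_comm]
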